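/- arXiv:2502.11787 — 6 statements merged into one kernel-verified Lean document; each statement's English description precedes it below -/
import Mathlib

section
/- Let K be a field, n ≥ 1, and P = K[x, y₁, …, yₙ] the commutative polynomial ring in n+1 variables. Let I ⊆ P be an ideal of dimension zero, i.e., t := dim_K P/I is finite, and assume |K| > t(t−1)/2 (the binomial coefficient (t choose 2)). Then there exist constants c₁, …, cₙ ∈ K such that the image of I under the K-algebra automorphism of P determined by x ↦ x + c₁y₁ + c₂y₂ + ⋯ + cₙyₙ and yᵢ ↦ yᵢ (for all i) is an ideal in normal position with respect to x. -/
open MvPolynomial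

noncomputable section

variable {K : Type*} [Field K] {n : ℕ}

/-- The set of common zeros of an ideal `I ⊆ K[x, y₁, …, yₙ]` in an algebraic
closure of `K`; the variable `x` is the variable of index `0`. -/
def VI (I : Ideal (MvPolynomial (Fin (n + 1)) K)) :
    Set (Fin (n + 1) → AlgebraicClosure K) :=
  {v | ∀ q ∈ I, (aeval v) q = 0}

/-- An ideal `I ⊆ K[x, y₁, …, yₙ]` is in normal position w.r.t. `x` if any two
distinct points of `V(I)` have distinct `x`-coordinates. -/
def NormalPosition (I : Ideal (MvPolynomial (Fin (n + 1)) K)) : Prop :=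
  ∀ a ∈ VI I, ∀ b ∈ VI I, a 0 = b 0 → a = b

/-- The elimination ideal `I ∩ K[x]`, realized as the preimage of `I` under the
inclusion `K[x] → K[x, y₁, …, yₙ]` sending the variable to `x` (index `0`). -/
def elimIdeal (I : Ideal (MvPolynomial (Fin (n + 1)) K)) : Ideal (Polynomial K) :=
  I.comap (Polynomial.aeval (X 0 : MvPolynomial (Fin (n + 1)) K) :
    Polynomial K →ₐ[K] MvPolynomial (Fin (n + 1)) K)

end

/-- The affine-linear form whose zeros are the `c` with `∑ i, c i * (a (i + 1) - b (i + 1)) =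
a 0 - b 0`. -/
noncomputable def collisionForm {L : Type*} [Field L] {n : ℕ} (a b : Fin (n + 1) → L) :
    MvPolynomial (Fin n) L :=
  ∑ i : Fin n, C (a i.succ - b i.succ) * X i - C (a 0 - b 0)

theorem eval_collisionForm {L : Type*} [Field L] {n : ℕ} (a b : Fin (n + 1) → L) (c : Fin n → L) :
    eval c (collisionForm a b) = ∑ i : Fin n, (a i.succ - b i.succ) * c i - (a 0 - b 0) := by
  simp [collisionForm]

theorem degreeOf_collisionForm_le {L : Type*} [Field L] {n : ℕ} (a b : Fin (n + 1) → L)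
    (j : Fin n) : (collisionForm a b).degreeOf j ≤ 1 := by
  refine (degreeOf_le_totalDegree _ _).trans ((totalDegree_sub _ _).trans ?_)
  rw [totalDegree_C, max_le_iff]
  refine ⟨totalDegree_finsetSum_le fun i _ => ?_, Nat.zero_le _⟩
  exact (totalDegree_mul _ _).trans (by rw [totalDegree_C, totalDegree_X])

theorem collisionForm_ne_zero {L : Type*} [Field L] {n : ℕ} {a b : Fin (n + 1) → L} (h : a ≠ b) :
    collisionForm a b ≠ 0 := by
  intro h0
  have heval (c : Fin n → L) : ∑ i : Fin n, (a i.succ - b i.succ) * c i - (a 0 - b 0) = 0 := by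
    rw [← eval_collisionForm, h0, map_zero]
  have hzero : a 0 - b 0 = 0 := by
    rw [← neg_eq_zero]
    simpa only [Pi.zero_apply, mul_zero, Finset.sum_const_zero, zero_sub] using heval 0
  refine h (funext fun j => Fin.cases (sub_eq_zero.mp hzero) (fun i => ?_) j)
  have hi := heval (Pi.single i 1)
  rw [hzero] at hi
  simpa [Pi.single_apply, sub_eq_zero] using hi

/-- Fewer than `#K` nonzero polynomials of degree at most one in each variable, with coefficients
in an extension of `K`, have a common non-zero with coordinates in `K`. -/
theorem exists_forall_eval_ne_zero {K L ι σ : Type*} [Field K] [Field L] [Algebra K L] [Finite σ]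
    (s : Finset ι) (f : ι → MvPolynomial σ L) (hf : ∀ z ∈ s, f z ≠ 0)
    (hdeg : ∀ z ∈ s, ∀ j, (f z).degreeOf j ≤ 1) (hcard : (s.card : Cardinal) < Cardinal.mk K) :
    ∃ c : σ → K, ∀ z ∈ s, eval (fun i => algebraMap K L (c i)) (f z) ≠ 0 := by
  obtain ⟨S, hS⟩ := Cardinal.exists_finset_le_card K (s.card + 1) (by
    rw [Nat.cast_add_one, ← Cardinal.succ_natCast]
    exact Order.succ_le_of_lt hcard)
  have hprod : ∏ z ∈ s, f z ≠ 0 := Finset.prod_ne_zero_iff.mpr hf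
  contrapose! hprod
  refine eq_zero_of_eval_zero_at_prod_finset _
    (fun _ => S.map ⟨algebraMap K L, (algebraMap K L).injective⟩) (fun j => ?_) fun x hx => ?_
  · rw [Finset.card_map]
    refine ((degreeOf_prod_le _ _ _).trans (Finset.sum_le_card_nsmul _ _ 1 ?_)).trans_lt ?_
    · exact fun z hz => hdeg z hz j
    · rw [smul_eq_mul, mul_one]
      exact hS
  · simp only [Finset.mem_map, Function.Embedding.coeFn_mk] at hx
    choose c _ hc using hx
    obtain ⟨z, hz, hzero⟩ := hprod c
    rw [eval_prod]
    exact Finset.prod_eq_zero hz (by rwa [← funext hc])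

theorem exists_forall_sum_ne {K L : Type*} [Field K] [Field L] [Algebra K L] {n : ℕ}
    (V : Finset (Fin (n + 1) → L)) (hcard : (V.card.choose 2 : Cardinal) < Cardinal.mk K) :
    ∃ c : Fin n → K, ∀ a ∈ V, ∀ b ∈ V, a ≠ b →
      ∑ i : Fin n, (a i.succ - b i.succ) * algebraMap K L (c i) ≠ a 0 - b 0 := by
  classical
  have hmem (z) (hz : z ∈ V.offDiag.image Sym2.mk.uncurry) : (Quot.out z).1 ≠ (Quot.out z).2 := by
    obtain ⟨⟨a, b⟩, hab, rfl⟩ := Finset.mem_image.mp hz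
    intro h
    have hd : (s(a, b)).IsDiag := by
      rw [← Quot.out_eq s(a, b)]
      exact h
    exact (Finset.mem_offDiag.mp hab).2.2 hd
  obtain ⟨c, hc⟩ := exists_forall_eval_ne_zero (K := K) (V.offDiag.image Sym2.mk.uncurry)
    (fun z => collisionForm (Quot.out z).1 (Quot.out z).2)
    (fun z hz => collisionForm_ne_zero (hmem z hz))
    (fun z _ j => degreeOf_collisionForm_le _ _ j) (by rwa [Sym2.card_image_offDiag])
  refine ⟨c, fun a ha b hb hab h => ?_⟩
  have hne := hc s(a, b)
    (Finset.mem_image.mpr ⟨(a, b), Finset.mem_offDiag.mpr ⟨ha, hb, hab⟩, rfl⟩)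
  rw [eval_collisionForm] at hne
  have hout : s((Quot.out s(a, b)).1, (Quot.out s(a, b)).2) = s(a, b) := Quot.out_eq s(a, b)
  rcases Sym2.eq_iff.mp hout with ⟨h1, h2⟩ | ⟨h1, h2⟩ <;> rw [h1, h2] at hne <;> apply hne
  · rw [h, sub_self]
  · rw [← neg_sub (a 0), ← h, sub_neg_eq_add, ← Finset.sum_add_distrib]
    exact Finset.sum_eq_zero fun i _ => by ring

/-- Evaluation at a common zero of `I`, as a map on the quotient by `I`. -/
noncomputable def quotientEval {K : Type*} [Field K] {n : ℕ}
    (I : Ideal (MvPolynomial (Fin (n + 1)) K)) (v : VI I) :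
    (MvPolynomial (Fin (n + 1)) K ⧸ I) →ₐ[K] AlgebraicClosure K :=
  Ideal.Quotient.liftₐ I (aeval v.1) v.2

theorem quotientEval_injective {K : Type*} [Field K] {n : ℕ}
    (I : Ideal (MvPolynomial (Fin (n + 1)) K)) : Function.Injective (quotientEval I) := by
  intro v w h
  refine Subtype.ext (funext fun j => ?_)
  have hj : aeval v.1 (X j : MvPolynomial (Fin (n + 1)) K) = aeval w.1 (X j) :=
    DFunLike.congr_fun h (Ideal.Quotient.mk I (X j))
  simpa only [aeval_X] using hj

theorem VI_finite {K : Type*} [Field K] {n : ℕ} (I : Ideal (MvPolynomial (Fin (n + 1)) K))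
    [FiniteDimensional K (MvPolynomial (Fin (n + 1)) K ⧸ I)] : (VI I).Finite :=
  Set.finite_coe_iff.mp (Finite.of_injective _ (quotientEval_injective I))

theorem ncard_VI_le {K : Type*} [Field K] {n : ℕ} (I : Ideal (MvPolynomial (Fin (n + 1)) K))
    [FiniteDimensional K (MvPolynomial (Fin (n + 1)) K ⧸ I)] :
    (VI I).ncard ≤ Module.finrank K (MvPolynomial (Fin (n + 1)) K ⧸ I) :=
  (Nat.card_le_card_of_injective _ (quotientEval_injective I)).trans
    (card_algHom_le_finrank K _ _)

theorem aeval_mem_VI_of_mem_VI_map {K : Type*} [Field K] {n : ℕ}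
    {I : Ideal (MvPolynomial (Fin (n + 1)) K)} {g : Fin (n + 1) → MvPolynomial (Fin (n + 1)) K}
    {v : Fin (n + 1) → AlgebraicClosure K}
    (hv : v ∈ VI (I.map (aeval g : MvPolynomial (Fin (n + 1)) K →ₐ[K] _))) :
    (fun j => aeval v (g j)) ∈ VI I := by
  intro q hq
  have := hv _ (Ideal.mem_map_of_mem _ hq)
  rwa [← AlgHom.comp_apply, comp_aeval] at this

/-- Differential analog context, Thm 1 (commutative version):
a zero-dimensional ideal with `|K| > (t choose 2)` can be brought into normal
position by the change of variables `x ↦ x + c₁y₁ + ⋯ + cₙyₙ`. -/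
theorem normal_position_after_change_of_variables
    (K : Type*) [Field K] (n : ℕ) (hn : 1 ≤ n)
    (I : Ideal (MvPolynomial (Fin (n + 1)) K))
    (hfin : FiniteDimensional K (MvPolynomial (Fin (n + 1)) K ⧸ I))
    (hcard : (Nat.choose (Module.finrank K (MvPolynomial (Fin (n + 1)) K ⧸ I)) 2 :
      Cardinal) < Cardinal.mk K) :
    ∃ c : Fin n → K,
      NormalPosition (I.map (aeval (fun j : Fin (n + 1) =>
          if j = 0 then X 0 + ∑ i : Fin n, C (c i) * X i.succ else X j) :
        MvPolynomial (Fin (n + 1)) K →ₐ[K] MvPolynomial (Fin (n + 1)) K)) := by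
  have hV := VI_finite I
  obtain ⟨c, hc⟩ := exists_forall_sum_ne (K := K) hV.toFinset (by
    rw [← Set.ncard_eq_toFinset_card _ hV]
    refine lt_of_le_of_lt ?_ hcard
    exact_mod_cast Nat.choose_le_choose 2 (ncard_VI_le I))
  refine ⟨c, fun a ha b hb h0 => ?_⟩
  have ha' := aeval_mem_VI_of_mem_VI_map ha
  have hb' := aeval_mem_VI_of_mem_VI_map hb
  by_contra hab
  refine hc _ (hV.mem_toFinset.mpr ha') _ (hV.mem_toFinset.mpr hb') (fun h => hab ?_) ?_
  · refine funext fun j => Fin.cases h0 (fun i => ?_) j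
    simpa using congrFun h i.succ
  · simp only [Fin.succ_ne_zero, if_false, if_true, map_add, map_sum, map_mul, aeval_X, aeval_C, h0,
      add_sub_add_left_eq_sub, ← Finset.sum_sub_distrib]
    exact Finset.sum_congr rfl fun i _ => by ring
end

section
/- Let K be a perfect field, n ≥ 1, P = K[x, y₁, …, yₙ], and let I ⊆ P be a radical ideal of dimension zero. Let p ∈ K[x] be a generator of the elimination ideal I ∩ K[x]. If I is in normal position with respect to x, then deg(p) = dim_K P/I. -/
open MvPolynomial

open scoped TensorProduct in
/-- A formally étale finite-dimensional algebra has at least as many points in a separably closed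
extension as its dimension. -/
theorem Algebra.FormallyEtale.finrank_le_card_algHom (K A Ω : Type*) [Field K] [CommRing A]
    [Algebra K A] [FiniteDimensional K A] [Algebra.FormallyEtale K A] [Field Ω] [Algebra K Ω]
    [IsSepClosed Ω] : Module.finrank K A ≤ Nat.card (A →ₐ[K] Ω) := by
  classical
  let e := Algebra.FormallyEtale.equivPiOfIsSepClosed Ω (Ω ⊗[K] A)
  have : IsArtinianRing (Ω ⊗[K] A) := .of_finite Ω _
  have : Fintype (PrimeSpectrum (Ω ⊗[K] A)) := Fintype.ofFinite _
  have hcard : Module.finrank K A = Nat.card (PrimeSpectrum (Ω ⊗[K] A)) := by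
    rw [← Module.finrank_baseChange (R := Ω), e.toLinearEquiv.finrank_eq,
      Module.finrank_fintype_fun_eq_card, Nat.card_eq_fintype_card]
  rw [hcard]
  let g (q : PrimeSpectrum (Ω ⊗[K] A)) : Ω ⊗[K] A →ₐ[Ω] Ω :=
    (Pi.evalAlgHom Ω (fun _ ↦ Ω) q).comp e.toAlgHom
  refine Nat.card_le_card_of_injective
    (fun q ↦ ((g q).restrictScalars K).comp Algebra.TensorProduct.includeRight) fun q r hqr ↦ ?_
  have hg : g q = g r := Algebra.TensorProduct.ext (by ext) hqr
  by_contra hne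
  have := DFunLike.congr_fun hg (e.symm (Pi.single q 1))
  simp [g, Pi.single_eq_of_ne (Ne.symm hne)] at this

/-- A reduced finite-dimensional algebra over a perfect field is formally étale. -/
theorem Algebra.FormallyEtale.of_isReduced_of_perfectField (K A : Type*) [Field K] [PerfectField K]
    [CommRing A] [Algebra K A] [FiniteDimensional K A] [IsReduced A] :
    Algebra.FormallyEtale K A := by
  have : IsArtinianRing A := .of_finite K A
  let (m : MaximalSpectrum A) : Field (A ⧸ m.asIdeal) := Ideal.Quotient.field m.asIdeal
  exact (Algebra.FormallyEtale.iff_exists_algEquiv_prod K A).mpr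
    ⟨MaximalSpectrum A, inferInstance, fun m ↦ A ⧸ m.asIdeal, inferInstance, inferInstance,
      (IsArtinianRing.equivPi A).restrictScalars K, fun _ ↦ inferInstance⟩

/-- If the points of `A` in a field extension are separated by their values at `a`, then there
are at most `p.natDegree` of them for any nonzero polynomial `p` annihilating `a`. -/
theorem Polynomial.card_algHom_le_natDegree {K A Ω : Type*} [Field K] [CommRing A] [Algebra K A]
    [Field Ω] [Algebra K Ω] {p : Polynomial K} (hp : p ≠ 0) {a : A}
    (ha : Polynomial.aeval a p = 0)
    (hinj : Function.Injective fun f : A →ₐ[K] Ω ↦ f a) :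
    Nat.card (A →ₐ[K] Ω) ≤ p.natDegree := by
  classical
  have hroot (f : A →ₐ[K] Ω) : f a ∈ (p.aroots Ω).toFinset := by
    rw [Multiset.mem_toFinset, Polynomial.mem_aroots]
    exact ⟨hp, by rw [Polynomial.aeval_algHom_apply, ha, map_zero]⟩
  calc Nat.card (A →ₐ[K] Ω) ≤ Nat.card (p.aroots Ω).toFinset :=
        Nat.card_le_card_of_injective (fun f ↦ ⟨f a, hroot f⟩)
          fun f g h ↦ hinj (congrArg Subtype.val h)
    _ ≤ (p.aroots Ω).card := by
        rw [Nat.card_eq_fintype_card, Fintype.card_coe]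
        exact Multiset.toFinset_card_le _
    _ ≤ p.natDegree := (Polynomial.card_roots' _).trans_eq (Polynomial.natDegree_map _)

/-- In normal position, a point of the quotient algebra is determined by its first coordinate. -/
theorem NormalPosition.injective_eval_mk_X {K : Type*} [Field K] {n : ℕ}
    {I : Ideal (MvPolynomial (Fin (n + 1)) K)} (hnp : NormalPosition I) :
    Function.Injective fun f : (MvPolynomial (Fin (n + 1)) K ⧸ I) →ₐ[K] AlgebraicClosure K ↦
      f (Ideal.Quotient.mkₐ K I (X 0)) := by
  intro f g hfg
  have haeval (f : (MvPolynomial (Fin (n + 1)) K ⧸ I) →ₐ[K] AlgebraicClosure K) :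
      aeval (fun i ↦ f (Ideal.Quotient.mkₐ K I (X i))) = f.comp (Ideal.Quotient.mkₐ K I) := by
    ext i
    simp
  have hmem (f : (MvPolynomial (Fin (n + 1)) K ⧸ I) →ₐ[K] AlgebraicClosure K) :
      (fun i ↦ f (Ideal.Quotient.mkₐ K I (X i))) ∈ VI I := by
    intro q hq
    have hq' : Ideal.Quotient.mkₐ K I q = 0 := Ideal.Quotient.eq_zero_iff_mem.mpr hq
    rw [haeval, AlgHom.comp_apply, hq', map_zero]
  have hcoord := hnp _ (hmem f) _ (hmem g) hfg
  have hcomp : f.comp (Ideal.Quotient.mkₐ K I) = g.comp (Ideal.Quotient.mkₐ K I) := by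
    rw [← haeval, ← haeval, hcoord]
  exact (AlgHom.cancel_right (Ideal.Quotient.mkₐ_surjective K I)).mp hcomp

/-- If a radical zero-dimensional ideal is in normal position w.r.t. `x`, then
the degree of the generator of the elimination ideal equals `dim_K P/I`. -/
theorem natDegree_eq_finrank_of_normalPosition
    (K : Type*) [Field K] [PerfectField K] (n : ℕ) (hn : 1 ≤ n)
    (I : Ideal (MvPolynomial (Fin (n + 1)) K)) (hrad : I.IsRadical)
    (hfin : FiniteDimensional K (MvPolynomial (Fin (n + 1)) K ⧸ I))
    (p : Polynomial K) (hp : elimIdeal I = Ideal.span {p})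
    (hnp : NormalPosition I) :
    p.natDegree = Module.finrank K (MvPolynomial (Fin (n + 1)) K ⧸ I) := by
  have hred : IsReduced (MvPolynomial (Fin (n + 1)) K ⧸ I) :=
    (Ideal.isRadical_iff_quotient_reduced I).mp hrad
  have : Algebra.FormallyEtale K (MvPolynomial (Fin (n + 1)) K ⧸ I) :=
    .of_isReduced_of_perfectField K _
  set a := Ideal.Quotient.mkₐ K I (X 0)
  have hker (q : Polynomial K) : Polynomial.aeval a q = 0 ↔ p ∣ q := by
    rw [← Ideal.mem_span_singleton, ← hp, elimIdeal, Ideal.mem_comap,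
      Polynomial.aeval_algHom_apply]
    exact Ideal.Quotient.eq_zero_iff_mem
  have hint : IsIntegral K a := Algebra.IsIntegral.isIntegral a
  have hdvd : p ∣ minpoly K a := (hker _).mp (minpoly.aeval K a)
  have hp0 : p ≠ 0 := fun h ↦ minpoly.ne_zero hint (zero_dvd_iff.mp (h ▸ hdvd))
  apply le_antisymm
  · exact (Polynomial.natDegree_le_of_dvd hdvd (minpoly.ne_zero hint)).trans
      (minpoly.natDegree_le a)
  · exact (Algebra.FormallyEtale.finrank_le_card_algHom K _ (AlgebraicClosure K)).trans
      (Polynomial.card_algHom_le_natDegree hp0 ((hker p).mpr dvd_rfl) hnp.injective_eval_mk_X)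
end

section
/- Let K be a perfect field, n ≥ 1, P = K[x, y₁, …, yₙ], and let I ⊆ P be a radical ideal of dimension zero. Let p ∈ K[x] be a generator of the elimination ideal I ∩ K[x]. If deg(p) = dim_K P/I, then I is in normal position with respect to x. -/
open MvPolynomial

/-- A linear map from `K[X]` to a space of dimension `deg p` whose kernel consists of multiples
of `p` is surjective. -/
theorem Polynomial.surjective_of_natDegree_eq_finrank_of_map_eq_zero_imp_dvd
    {K V : Type*} [Field K] [AddCommGroup V] [Module K V] [FiniteDimensional K V]
    (φ : Polynomial K →ₗ[K] V) (p : Polynomial K) (hφ : ∀ f, φ f = 0 → p ∣ f)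
    (hdeg : p.natDegree = Module.finrank K V) :
    Function.Surjective φ := by
  let e := (Polynomial.degreeLTEquiv K p.natDegree).symm
  let ψ : (Fin p.natDegree → K) →ₗ[K] V :=
    φ ∘ₗ (Polynomial.degreeLT K p.natDegree).subtype ∘ₗ e.toLinearMap
  have hinj : Function.Injective ψ := by
    rw [injective_iff_map_eq_zero]
    intro c hc
    have hmem := Polynomial.mem_degreeLT.mp (e c).2
    have hzero : (e c : Polynomial K) = 0 := by
      by_contra hne
      exact hne (Polynomial.eq_zero_of_dvd_of_natDegree_lt (hφ _ hc)
        ((Polynomial.natDegree_lt_iff_degree_lt hne).mpr hmem))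
    exact e.map_eq_zero_iff.mp (Subtype.ext hzero)
  have hsurj : Function.Surjective ψ :=
    (LinearMap.injective_iff_surjective_of_finrank_eq_finrank (by simp [hdeg])).mp hinj
  intro v
  obtain ⟨c, hc⟩ := hsurj v
  exact ⟨e c, hc⟩

/-- If the degree of the generator of the elimination ideal of a radical
zero-dimensional ideal equals `dim_K P/I`, then the ideal is in normal
position w.r.t. `x`. -/
theorem normalPosition_of_natDegree_eq_finrank
    (K : Type*) [Field K] [PerfectField K] (n : ℕ) (hn : 1 ≤ n)
    (I : Ideal (MvPolynomial (Fin (n + 1)) K)) (hrad : I.IsRadical)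
    (hfin : FiniteDimensional K (MvPolynomial (Fin (n + 1)) K ⧸ I))
    (p : Polynomial K) (hp : elimIdeal I = Ideal.span {p})
    (hdeg : p.natDegree = Module.finrank K (MvPolynomial (Fin (n + 1)) K ⧸ I)) :
    NormalPosition I := by
  let π : Polynomial K →ₐ[K] MvPolynomial (Fin (n + 1)) K ⧸ I :=
    (Ideal.Quotient.mkₐ K I).comp (Polynomial.aeval (X 0))
  have hsurj : Function.Surjective π := by
    refine Polynomial.surjective_of_natDegree_eq_finrank_of_map_eq_zero_imp_dvd
      π.toLinearMap p (fun f hf => ?_) hdeg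
    rw [← Ideal.mem_span_singleton, ← hp]
    have h : Polynomial.aeval (X 0) f ∈ I := Ideal.Quotient.eq_zero_iff_mem.mp hf
    exact h
  intro a ha b hb hab
  funext i
  obtain ⟨f, hf⟩ := hsurj (Ideal.Quotient.mk I (X i))
  have hmem : Polynomial.aeval (X 0) f - X i ∈ I := Ideal.Quotient.eq.mp hf
  have coord : ∀ v ∈ VI I, v i = Polynomial.aeval (v 0) f := by
    intro v hv
    have h := hv _ hmem
    rw [map_sub, aeval_X, ← Polynomial.aeval_algHom_apply, aeval_X, sub_eq_zero] at h
    exact h.symm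
  rw [coord a ha, coord b hb, hab]
end

section
/- (Shape Lemma) Let K be a perfect field, n ≥ 1, P = K[x, y₁, …, yₙ], and let I ⊆ P be a radical ideal of dimension zero that is in normal position with respect to x. Let p ∈ K[x] be a generator of the elimination ideal I ∩ K[x]. Then there exist polynomials q₁, …, qₙ ∈ K[x] with deg(qᵢ) < deg(p) for all i such that the set {y₁ − q₁, …, yₙ − qₙ, p} generates the ideal I. -/
open MvPolynomial

/-- An ideal with finite-dimensional quotient meets `K[x]` nontrivially. -/
lemma elimIdeal_ne_bot {K : Type*} [Field K] {n : ℕ}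
    (I : Ideal (MvPolynomial (Fin (n + 1)) K))
    [FiniteDimensional K (MvPolynomial (Fin (n + 1)) K ⧸ I)] : elimIdeal I ≠ ⊥ := by
  obtain ⟨f, hf, hf0⟩ := Algebra.IsIntegral.isIntegral (R := K)
    (Ideal.Quotient.mkₐ K I (X 0))
  refine (Submodule.ne_bot_iff _).2 ⟨f, ?_, hf.ne_zero⟩
  rw [elimIdeal, Ideal.mem_comap, ← Ideal.Quotient.eq_zero_iff_mem]
  change Ideal.Quotient.mkₐ K I _ = 0
  rw [← Polynomial.aeval_algHom_apply]
  exact hf0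

/-- An ideal in normal position with finite-dimensional quotient has finitely many zeros. -/
lemma NormalPosition.finite_VI {K : Type*} [Field K] {n : ℕ}
    {I : Ideal (MvPolynomial (Fin (n + 1)) K)} (hnp : NormalPosition I)
    [FiniteDimensional K (MvPolynomial (Fin (n + 1)) K ⧸ I)] : (VI I).Finite := by
  obtain ⟨f, hf, hf0⟩ := (Submodule.ne_bot_iff _).1 (elimIdeal_ne_bot I)
  refine Set.Finite.of_finite_image (f := fun v ↦ v 0)
    ((f.rootSet_finite (AlgebraicClosure K)).subset ?_) fun a ha b hb h ↦ hnp a ha b hb h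
  rintro _ ⟨v, hv, rfl⟩
  refine Polynomial.mem_rootSet.2 ⟨hf0, ?_⟩
  have h := hv _ hf
  rwa [← Polynomial.aeval_algHom_apply, aeval_X] at h

/-- The zero set of an ideal is stable under automorphisms of the algebraic closure. -/
lemma algEquiv_comp_mem_VI {K : Type*} [Field K] {n : ℕ}
    {I : Ideal (MvPolynomial (Fin (n + 1)) K)} (σ : Gal(AlgebraicClosure K/K))
    {v : Fin (n + 1) → AlgebraicClosure K} (hv : v ∈ VI I) : (fun j ↦ σ (v j)) ∈ VI I := by
  intro q hq
  have h : aeval (fun j ↦ σ (v j)) q = σ (aeval v q) :=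
    DFunLike.congr_fun (comp_aeval v (σ : AlgebraicClosure K →ₐ[K] AlgebraicClosure K)).symm q
  rw [h, hv q hq, map_zero]

/-- A polynomial over a Galois extension that is fixed by the Galois group is defined over the
base field. -/
lemma exists_map_eq_of_forall_map_eq {K L : Type*} [Field K] [Field L] [Algebra K L] [IsGalois K L]
    {Q : Polynomial L} (hQ : ∀ σ : Gal(L/K), Q.map (σ : L →+* L) = Q) :
    ∃ q : Polynomial K, q.map (algebraMap K L) = Q := by
  refine (Polynomial.mem_lifts _).1 <| (Polynomial.lifts_iff_coeff_lifts _).2 fun k ↦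
    (InfiniteGalois.mem_range_algebraMap_iff_fixed _).2 fun σ ↦ ?_
  conv_rhs => rw [← hQ σ, Polynomial.coeff_map]
  rfl

/-- If a finite Galois-stable set of points is separated by the coordinate `i`, then on this set
every coordinate is a polynomial over the base field in the coordinate `i`. -/
lemma exists_aeval_eq_of_injOn {K L ι : Type*} [Field K] [Field L] [Algebra K L] [IsGalois K L]
    (s : Finset (ι → L)) (hs : ∀ σ : Gal(L/K), ∀ v ∈ s, (fun j ↦ σ (v j)) ∈ s) (i j : ι)
    (hinj : Set.InjOn (fun v : ι → L ↦ v i) s) :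
    ∃ q : Polynomial K, ∀ v ∈ s, Polynomial.aeval (v i) q = v j := by
  classical
  obtain ⟨Q, hdeg, hQ⟩ : ∃ Q : Polynomial L, Q.degree < s.card ∧ ∀ v ∈ s, Q.eval (v i) = v j := by
    refine ⟨Lagrange.interpolate s (fun v ↦ v i) (fun v ↦ v j), ?_, fun v hv ↦ ?_⟩
    · exact Lagrange.degree_interpolate_lt (v := fun v : ι → L ↦ v i) _ hinj
    · exact Lagrange.eval_interpolate_at_node (v := fun v : ι → L ↦ v i) (fun v ↦ v j) hinj hv
  have map_Q (σ : Gal(L/K)) : Q.map (σ : L →+* L) = Q := by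
    refine Polynomial.eq_of_degrees_lt_of_eval_index_eq (v := fun v : ι → L ↦ v i) s hinj
      (by rwa [Polynomial.degree_map]) hdeg fun v hv ↦ ?_
    have h := Polynomial.eval_map_apply (σ : L →+* L) (p := Q) (σ.symm (v i))
    rw [hQ _ (hs σ.symm v hv)] at h
    simpa [hQ v hv] using h
  obtain ⟨q, rfl⟩ := exists_map_eq_of_forall_map_eq map_Q
  exact ⟨q, fun v hv ↦ by rw [← hQ v hv, Polynomial.eval_map_algebraMap]⟩

/-- On the zero set of an ideal in normal position, every coordinate is a polynomial over the
base field in the first coordinate. -/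
lemma NormalPosition.exists_aeval_eq {K : Type*} [Field K] [PerfectField K] {n : ℕ}
    {I : Ideal (MvPolynomial (Fin (n + 1)) K)} (hnp : NormalPosition I)
    [FiniteDimensional K (MvPolynomial (Fin (n + 1)) K ⧸ I)] (j : Fin (n + 1)) :
    ∃ q : Polynomial K, ∀ v ∈ VI I, Polynomial.aeval (v 0) q = v j := by
  have hfin := hnp.finite_VI
  obtain ⟨q, hq⟩ := exists_aeval_eq_of_injOn (K := K) hfin.toFinset
    (fun σ v hv ↦ hfin.mem_toFinset.2 (algEquiv_comp_mem_VI σ (hfin.mem_toFinset.1 hv))) 0 j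
    (fun a ha b hb h ↦ hnp a (hfin.mem_toFinset.1 ha) b (hfin.mem_toFinset.1 hb) h)
  exact ⟨q, fun v hv ↦ hq v (hfin.mem_toFinset.2 hv)⟩

/-- Modulo an ideal containing `yᵢ - qᵢ(x)` for all `i`, every polynomial is congruent to a
polynomial in `x`. -/
lemma exists_sub_aeval_X_zero_mem {K : Type*} [Field K] {n : ℕ}
    {J : Ideal (MvPolynomial (Fin (n + 1)) K)} {q : Fin n → Polynomial K}
    (hJ : ∀ i, X i.succ - Polynomial.aeval (X 0 : MvPolynomial (Fin (n + 1)) K) (q i) ∈ J)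
    (f : MvPolynomial (Fin (n + 1)) K) :
    ∃ g : Polynomial K, f - Polynomial.aeval (X 0 : MvPolynomial (Fin (n + 1)) K) g ∈ J := by
  refine ⟨aeval (Fin.cons Polynomial.X q : Fin (n + 1) → Polynomial K) f, ?_⟩
  have h : Ideal.Quotient.mkₐ K J = ((Ideal.Quotient.mkₐ K J).comp
      (Polynomial.aeval (X 0 : MvPolynomial (Fin (n + 1)) K))).comp
        (aeval (Fin.cons Polynomial.X q : Fin (n + 1) → Polynomial K)) := by
    ext j
    refine Fin.cases ?_ (fun i ↦ ?_) j
    · simp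
    · simpa using Ideal.Quotient.eq.2 (hJ i)
  exact Ideal.Quotient.eq.1 (DFunLike.congr_fun h f)

/-- Shape Lemma: a radical zero-dimensional ideal in normal position w.r.t. `x`
has a basis `{y₁ - q₁, …, yₙ - qₙ, p}` with `qᵢ ∈ K[x]` of degree `< deg p`. -/
theorem shape_lemma
    (K : Type*) [Field K] [PerfectField K] (n : ℕ) (hn : 1 ≤ n)
    (I : Ideal (MvPolynomial (Fin (n + 1)) K)) (hrad : I.IsRadical)
    (hfin : FiniteDimensional K (MvPolynomial (Fin (n + 1)) K ⧸ I))
    (hnp : NormalPosition I)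
    (p : Polynomial K) (hp : elimIdeal I = Ideal.span {p}) :
    ∃ q : Fin n → Polynomial K,
      (∀ i, (q i).degree < p.degree) ∧
      I = Ideal.span
        (insert (Polynomial.aeval (X 0 : MvPolynomial (Fin (n + 1)) K) p)
          (Set.range fun i : Fin n =>
            X i.succ - Polynomial.aeval (X 0 : MvPolynomial (Fin (n + 1)) K) (q i))) := by
  have hp0 : p ≠ 0 := by
    rintro rfl
    exact elimIdeal_ne_bot I (by simpa using hp)
  have aeval_mem {f : Polynomial K} :
      Polynomial.aeval (X 0 : MvPolynomial (Fin (n + 1)) K) f ∈ I ↔ p ∣ f := by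
    rw [← Ideal.mem_span_singleton, ← hp]
    rfl
  choose r hr using fun i : Fin n ↦ hnp.exists_aeval_eq i.succ
  have hrI (i : Fin n) :
      X i.succ - Polynomial.aeval (X 0 : MvPolynomial (Fin (n + 1)) K) (r i) ∈ I := by
    rw [← hrad.radical, ← vanishingIdeal_zeroLocus_eq_radical (K := AlgebraicClosure K)]
    intro v hv
    rw [map_sub, ← Polynomial.aeval_algHom_apply, aeval_X, aeval_X, hr i v hv, sub_self]
  have hqI (i : Fin n) :
      X i.succ - Polynomial.aeval (X 0 : MvPolynomial (Fin (n + 1)) K) (r i % p) ∈ I := by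
    have h := I.add_mem (hrI i) (aeval_mem.2
      ⟨r i / p, sub_eq_of_eq_add (EuclideanDomain.div_add_mod (r i) p).symm⟩)
    rwa [map_sub, sub_add_sub_cancel] at h
  have hle : Ideal.span (insert (Polynomial.aeval (X 0 : MvPolynomial (Fin (n + 1)) K) p)
      (Set.range fun i : Fin n =>
        X i.succ - Polynomial.aeval (X 0 : MvPolynomial (Fin (n + 1)) K) (r i % p))) ≤ I := by
    rw [Ideal.span_le, Set.insert_subset_iff, Set.range_subset_iff]
    exact ⟨aeval_mem.2 dvd_rfl, hqI⟩
  refine ⟨fun i ↦ r i % p, fun i ↦ EuclideanDomain.mod_lt (r i) hp0,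
    le_antisymm (fun f hf ↦ ?_) hle⟩
  obtain ⟨g, hg⟩ := exists_sub_aeval_X_zero_mem
    (fun i ↦ Ideal.subset_span (Set.mem_insert_of_mem _ (Set.mem_range_self i))) f
  refine (Submodule.sub_mem_iff_left _ ?_).1 hg
  obtain ⟨c, rfl⟩ := aeval_mem.1 ((Submodule.sub_mem_iff_right _ hf).1 (hle hg))
  rw [map_mul]
  exact Ideal.mul_mem_right _ _ (Ideal.subset_span (Set.mem_insert _ _))
end

section
/- Let K be a field, n ≥ 1, P = K[x, y₁, …, yₙ], let I ⊆ P be a proper ideal of dimension zero, and let p ∈ K[x] be a generator of the elimination ideal I ∩ K[x]. Then for every ξ in an algebraic closure K̄ of K, p(ξ) = 0 if and only if there exist η₁, …, ηₙ ∈ K̄ such that (ξ, η₁, …, ηₙ) ∈ V(I). In other words, the roots of p in K̄ are precisely the x-coordinates of the points of V(I). -/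
open MvPolynomial

/-- Let `a` be an element of a `K`-algebra `A` and `p` a generator of the annihilating
ideal of `a`. Every root `ξ` of `p` in an algebraic closure is the value at `a` of some
`K`-algebra homomorphism, when `A` is finite-dimensional. -/
theorem exists_algHom_apply_eq_of_aeval_eq_zero {K A : Type*} [Field K] [CommRing A]
    [Algebra K A] [FiniteDimensional K A] (a : A) (p : Polynomial K)
    (hp : ∀ q : Polynomial K, Polynomial.aeval a q = 0 ↔ p ∣ q)
    (ξ : AlgebraicClosure K) (hξ : Polynomial.aeval ξ p = 0) :
    ∃ φ : A →ₐ[K] AlgebraicClosure K, φ a = ξ := by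
  have hint : IsIntegral K a := Algebra.IsIntegral.isIntegral a
  have hp0 : p ≠ 0 := by
    rintro rfl
    exact minpoly.ne_zero hint (zero_dvd_iff.mp ((hp _).mp (minpoly.aeval K a)))
  have hξint : IsIntegral K ξ := Algebra.IsIntegral.isIntegral ξ
  have hirr : Irreducible (minpoly K ξ) := minpoly.irreducible hξint
  have hnu : ¬ IsUnit (Polynomial.aeval a (minpoly K ξ)) := by
    intro hu
    obtain ⟨g, hg⟩ := minpoly.dvd K ξ hξ
    have h0 : Polynomial.aeval a (minpoly K ξ) * Polynomial.aeval a g = 0 := by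
      rw [← map_mul, ← hg]
      exact (hp p).mpr dvd_rfl
    obtain ⟨r, hr⟩ := (hp g).mp (hu.mul_right_eq_zero.mp h0)
    refine hirr.not_isUnit (IsUnit.of_mul_eq_one r (mul_left_cancel₀ hp0 ?_))
    calc p * (minpoly K ξ * r) = minpoly K ξ * (p * r) := by ring
      _ = p * 1 := by rw [← hr, ← hg, mul_one]
  obtain ⟨M, hM, haM⟩ := exists_max_ideal_of_mem_nonunits hnu
  let _ : Field (A ⧸ M) := Ideal.Quotient.field M
  have hroot : Polynomial.aeval (Ideal.Quotient.mkₐ K M a) (minpoly K ξ) = 0 := by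
    rw [Polynomial.aeval_algHom_apply]
    exact Ideal.Quotient.eq_zero_iff_mem.mpr haM
  have hmin : minpoly K ξ = minpoly K (Ideal.Quotient.mkₐ K M a) :=
    minpoly.eq_of_irreducible_of_monic hirr hroot (minpoly.monic hξint)
  obtain ⟨φ, hφ⟩ := IntermediateField.exists_algHom_of_splits_of_aeval
    (F := K) (E := A ⧸ M) (K := AlgebraicClosure K)
    (fun s => ⟨Algebra.IsIntegral.isIntegral s, IsAlgClosed.splits _⟩)
    (x := Ideal.Quotient.mkₐ K M a) (y := ξ) (by rw [← hmin]; exact minpoly.aeval K ξ)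
  exact ⟨φ.comp (Ideal.Quotient.mkₐ K M), hφ⟩

/-- The roots in `K̄` of a generator `p` of the elimination ideal `I ∩ K[x]` of
a proper zero-dimensional ideal `I` are exactly the `x`-coordinates of the
points of `V(I)`. -/
theorem roots_of_elim_generator_eq_x_coordinates
    (K : Type*) [Field K] (n : ℕ) (hn : 1 ≤ n)
    (I : Ideal (MvPolynomial (Fin (n + 1)) K)) (hI : I ≠ ⊤)
    (hfin : FiniteDimensional K (MvPolynomial (Fin (n + 1)) K ⧸ I))
    (p : Polynomial K) (hp : elimIdeal I = Ideal.span {p}) :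
    ∀ ξ : AlgebraicClosure K,
      Polynomial.aeval ξ p = 0 ↔ ∃ v ∈ VI I, v 0 = ξ := by
  intro ξ
  have hmem : ∀ q : Polynomial K,
      Polynomial.aeval (X 0 : MvPolynomial (Fin (n + 1)) K) q ∈ I ↔ p ∣ q := by
    intro q
    rw [← Ideal.mem_span_singleton, ← hp]
    rfl
  constructor
  · intro hξ
    obtain ⟨φ, hφ⟩ := exists_algHom_apply_eq_of_aeval_eq_zero
      (Ideal.Quotient.mkₐ K I (X 0)) p
      (fun q => by
        rw [Polynomial.aeval_algHom_apply, ← hmem]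
        exact Ideal.Quotient.eq_zero_iff_mem) ξ hξ
    refine ⟨fun i => φ (Ideal.Quotient.mkₐ K I (X i)), fun q hq => ?_, hφ⟩
    have hcomp : aeval (fun i => φ (Ideal.Quotient.mkₐ K I (X i))) =
        φ.comp (Ideal.Quotient.mkₐ K I) := by
      ext i
      simp
    rw [hcomp, AlgHom.comp_apply, Ideal.Quotient.mkₐ_eq_mk,
      Ideal.Quotient.eq_zero_iff_mem.mpr hq, map_zero]
  · rintro ⟨v, hv, rfl⟩
    have h := hv _ ((hmem p).mpr dvd_rfl)
    rwa [← Polynomial.aeval_algHom_apply, aeval_X] at h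
end

section
/- Let F be a differential field, i.e., a field equipped with a derivation D : F → F, and let C = {a ∈ F : D(a) = 0} be its field of constants. For elements f₁, …, f_r ∈ F, their Wronskian Wr(f₁, …, f_r) is the determinant of the r×r matrix whose (j, i)-entry is D^{j−1}(f_i) (the (j−1)-fold derivative of f_i), for 1 ≤ i, j ≤ r. Then Wr(f₁, …, f_r) = 0 if and only if f₁, …, f_r are linearly dependent over C, i.e., there exist a₁, …, a_r ∈ C, not all zero, with a₁f₁ + ⋯ + a_r f_r = 0. -/
namespace Derivation

/-- The iterates of a derivation are linear over the constants. -/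
theorem iterate_sum_constants_mul {F ι : Type*} [Field F] (D : Derivation ℤ F F)
    (s : Finset ι) (a f : ι → F) (ha : ∀ i, D (a i) = 0) (j : ℕ) :
    D^[j] (∑ i ∈ s, a i * f i) = ∑ i ∈ s, a i * D^[j] (f i) := by
  induction j with
  | zero => rfl
  | succ j ih =>
    simp only [Function.iterate_succ_apply', ih, map_sum, leibniz, smul_eq_mul, ha, mul_zero,
      add_zero]

/-- A linear relation over `F` satisfied by the first `s.card` derivatives of a family indexed
by `s` yields a linear relation over the constants. -/
theorem exists_constants_sum_mul_eq_zero {F ι : Type*} [Field F] (D : Derivation ℤ F F)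
    (f : ι → F) (s : Finset ι) (v : ι → F) (hv : ∃ i ∈ s, v i ≠ 0)
    (h : ∀ j < s.card, ∑ i ∈ s, v i * D^[j] (f i) = 0) :
    ∃ a : ι → F, (∀ i, D (a i) = 0) ∧ (∃ i ∈ s, a i ≠ 0) ∧ (∀ i ∉ s, a i = 0) ∧
      ∑ i ∈ s, a i * f i = 0 := by
  classical
  induction hn : s.card generalizing s v with
  | zero =>
    obtain ⟨i, hi, -⟩ := hv
    simp [Finset.card_eq_zero.mp hn] at hi
  | succ n ih =>
    obtain ⟨k, hk, hvk⟩ := hv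
    set w : ι → F := fun i => (v k)⁻¹ * v i with hw
    have hwk : w k = 1 := inv_mul_cancel₀ hvk
    have hws : ∀ j < n + 1, ∑ i ∈ s, w i * D^[j] (f i) = 0 := fun j hj => by
      simp only [hw, mul_assoc, ← Finset.mul_sum, h j (hn ▸ hj), mul_zero]
    by_cases hD : ∀ i ∈ s, D (w i) = 0
    · refine ⟨fun i => if i ∈ s then w i else 0, fun i => ?_, ⟨k, hk, by simp [hk, hwk]⟩,
        fun i hi => if_neg hi, ?_⟩
      · by_cases hi : i ∈ s <;> simp [hi, hD]
      · rw [← hws 0 n.succ_pos]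
        exact Finset.sum_congr rfl fun i hi => by simp [hi]
    · push Not at hD
      obtain ⟨m, hm, hDm⟩ := hD
      have hDk : D (w k) = 0 := by rw [hwk, D.map_one_eq_zero]
      have hmk : m ≠ k := fun e => hDm (e ▸ hDk)
      have hcard : (s.erase k).card = n := by rw [Finset.card_erase_of_mem hk, hn]; rfl
      obtain ⟨a, ha, ⟨i, hi, hai⟩, hout, hsum⟩ := ih (s.erase k) (fun i => D (w i))
        ⟨m, Finset.mem_erase.mpr ⟨hmk, hm⟩, hDm⟩ (fun j hj => by
          rw [hcard] at hj
          rw [Finset.sum_erase _ (by rw [hDk, zero_mul])]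
          have h₁ := congrArg D (hws j (by lia))
          have h₂ := hws (j + 1) (by lia)
          simp only [Function.iterate_succ_apply'] at h₂
          simp only [map_sum, leibniz, smul_eq_mul, map_zero, Finset.sum_add_distrib, h₂,
            zero_add] at h₁
          simpa only [mul_comm] using h₁) hcard
      refine ⟨a, ha, ⟨i, Finset.mem_of_mem_erase hi, hai⟩,
        fun i hi => hout i fun hi' => hi (Finset.mem_of_mem_erase hi'), ?_⟩
      rwa [Finset.sum_erase _ (by rw [hout k (Finset.notMem_erase k s), zero_mul])] at hsum

end Derivation


/-- Wronskian criterion in a differential field: for `f₁, …, f_r` in a field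
`F` equipped with a derivation `D`, the Wronskian determinant
`det (D^(j-1) fᵢ)` vanishes iff the `fᵢ` are linearly dependent over the field
of constants `{a : F | D a = 0}`. -/
theorem wronskian_eq_zero_iff_linearDependent_over_constants
    (F : Type*) [Field F] (D : F → F)
    (hadd : ∀ a b : F, D (a + b) = D a + D b)
    (hleibniz : ∀ a b : F, D (a * b) = D a * b + a * D b)
    (r : ℕ) (f : Fin r → F) :
    Matrix.det (Matrix.of fun j i : Fin r => D^[(j : ℕ)] (f i)) = 0 ↔
      ∃ a : Fin r → F, (∀ i, D (a i) = 0) ∧ (∃ i, a i ≠ 0) ∧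
        ∑ i, a i * f i = 0 := by
  let D' : Derivation ℤ F F := Derivation.mk' (AddMonoidHom.mk' D hadd).toIntLinearMap
    fun a b => by
      change D (a * b) = a * D b + b * D a
      rw [hleibniz]; ring
  rw [← Matrix.exists_mulVec_eq_zero_iff]
  constructor
  · rintro ⟨v, hv, hmul⟩
    obtain ⟨i, hi⟩ := Function.ne_iff.mp hv
    obtain ⟨a, ha, ⟨k, -, hk⟩, -, hsum⟩ := D'.exists_constants_sum_mul_eq_zero f Finset.univ v
      ⟨i, Finset.mem_univ i, hi⟩ fun j hj => by
        have hj' : j < r := by simpa using hj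
        have := congrFun hmul ⟨j, hj'⟩
        simp only [Matrix.mulVec, dotProduct, Matrix.of_apply, Pi.zero_apply] at this
        simp only [mul_comm (v _)]
        exact this
    exact ⟨a, ha, ⟨k, hk⟩, hsum⟩
  · rintro ⟨a, ha, ⟨k, hk⟩, hsum⟩
    refine ⟨a, Function.ne_iff.mpr ⟨k, hk⟩, funext fun j => ?_⟩
    have hj : D'^[(j : ℕ)] (∑ i, a i * f i) = _ :=
      D'.iterate_sum_constants_mul Finset.univ a f ha j
    rw [hsum, iterate_map_zero] at hj
    simp only [Matrix.mulVec, dotProduct, Matrix.of_apply, Pi.zero_apply, mul_comm _ (a _)]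
    exact hj.symm
end
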